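/- arXiv:2406.14216 — 8 statements merged into one kernel-verified Lean document; each statement's English description precedes it below -/
import Mathlib

section
/- Let p ∈ (0,1), δ ∈ [1/2,1), α,β ∈ [1/2,1) be real numbers. Define D₀ = (1−α)(1−β) − (1−α−β)δ(1−p), D₁ = (1−α)β + (α−β)δ(1−p), D₂ = α(1−β) − (α−β)δ(1−p), D₃ = αβ + (1−α−β)δ(1−p), and N₀ = (1−α)(1−β)p + αβδ(1−p), N₁ = (1−α)βp + α(1−β)δ(1−p), N₂ = α(1−β)p + (1−α)βδ(1−p), N₃ = αβp + (1−α)(1−β)δ(1−p). Then each Dᵢ > 0, D₀ + D₁ + D₂ + D₃ = 1, and the weighted average ∑_{i=0}^{3} Dᵢ · ((1 − δ(1−p)) · Nᵢ / (2p·Dᵢ)) equals (1/2)·(1 + δ(1−δ)(1−p)²/p). -/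
/-- Eq. (a26) of the paper: the outcome probabilities `Dᵢ` of the measurement `M(β)`
are positive and sum to one, and the weighted average of the optimal fully entangled
fractions `(1 − δ(1−p))·Nᵢ/(2p·Dᵢ)` of the four post-measurement states equals
`(1/2)(1 + δ(1−δ)(1−p)²/p)`, the OFEF of the noisy state `ρ(p,δ)`. -/
theorem weighted_average_OFEF
    (p δ α β D₀ D₁ D₂ D₃ N₀ N₁ N₂ N₃ : ℝ)
    (hp0 : 0 < p) (hp1 : p < 1)
    (hδ0 : 1/2 ≤ δ) (hδ1 : δ < 1)
    (hα0 : 1/2 ≤ α) (hα1 : α < 1)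
    (hβ0 : 1/2 ≤ β) (hβ1 : β < 1)
    (hD₀ : D₀ = (1 - α) * (1 - β) - (1 - α - β) * δ * (1 - p))
    (hD₁ : D₁ = (1 - α) * β + (α - β) * δ * (1 - p))
    (hD₂ : D₂ = α * (1 - β) - (α - β) * δ * (1 - p))
    (hD₃ : D₃ = α * β + (1 - α - β) * δ * (1 - p))
    (hN₀ : N₀ = (1 - α) * (1 - β) * p + α * β * δ * (1 - p))
    (hN₁ : N₁ = (1 - α) * β * p + α * (1 - β) * δ * (1 - p))
    (hN₂ : N₂ = α * (1 - β) * p + (1 - α) * β * δ * (1 - p))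
    (hN₃ : N₃ = α * β * p + (1 - α) * (1 - β) * δ * (1 - p)) :
    (0 < D₀ ∧ 0 < D₁ ∧ 0 < D₂ ∧ 0 < D₃) ∧
    D₀ + D₁ + D₂ + D₃ = 1 ∧
    D₀ * ((1 - δ * (1 - p)) * N₀ / (2 * p * D₀)) +
      D₁ * ((1 - δ * (1 - p)) * N₁ / (2 * p * D₁)) +
      D₂ * ((1 - δ * (1 - p)) * N₂ / (2 * p * D₂)) +
      D₃ * ((1 - δ * (1 - p)) * N₃ / (2 * p * D₃)) =
      (1/2) * (1 + δ * (1 - δ) * (1 - p)^2 / p) := by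
  have hs0 : 0 < δ * (1 - p) := mul_pos (by linarith) (by linarith)
  have hs1 : δ * (1 - p) < 1 := by nlinarith
  have mix_pos {a b : ℝ} (ha : 0 < a) (hb : 0 < b) :
      0 < a * (1 - δ * (1 - p)) + b * (δ * (1 - p)) :=
    add_pos (mul_pos ha (sub_pos.2 hs1)) (mul_pos hb hs0)
  have hα : 0 < α := by linarith
  have hβ : 0 < β := by linarith
  have hα' : 0 < 1 - α := sub_pos.2 hα1
  have hβ' : 0 < 1 - β := sub_pos.2 hβ1
  have h₀ : 0 < D₀ := by
    linear_combination mix_pos (mul_pos hα' hβ') (mul_pos hα hβ) - hD₀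
  have h₁ : 0 < D₁ := by
    linear_combination mix_pos (mul_pos hα' hβ) (mul_pos hα hβ') - hD₁
  have h₂ : 0 < D₂ := by
    linear_combination mix_pos (mul_pos hα hβ') (mul_pos hα' hβ) - hD₂
  have h₃ : 0 < D₃ := by
    linear_combination mix_pos (mul_pos hα hβ) (mul_pos hα' hβ') - hD₃
  refine ⟨⟨h₀, h₁, h₂, h₃⟩, by linear_combination hD₀ + hD₁ + hD₂ + hD₃, ?_⟩
  have cancel {D : ℝ} (hD : 0 < D) (x : ℝ) : D * (x / (2 * p * D)) = x / (2 * p) := by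
    field_simp
  rw [cancel h₀, cancel h₁, cancel h₂, cancel h₃, hN₀, hN₁, hN₂, hN₃]
  field_simp
  ring
end

section
/- Let p ∈ (0,1), δ ∈ [1/2,1), α,β ∈ [1/2,1) and set K = δ(1−δ)(1−p)². The four inequalities αβK ≤ (1−α)(1−β)p², α(1−β)K ≤ (1−α)βp², (1−α)βK ≤ α(1−β)p², and (1−α)(1−β)K ≤ αβp² hold simultaneously if and only if β ≤ (1−α)p² / ((1−α)p² + αK). -/
/-- The four teleportation constraints (a18)–(a21) hold simultaneously iff
`β ≤ (1−α)p²/((1−α)p² + αK)`, where `K = δ(1−δ)(1−p)²` (Eq. (a25)). -/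
theorem four_constraints_iff_beta_bound
    (p δ α β K : ℝ)
    (hp0 : 0 < p) (hp1 : p < 1)
    (hδ0 : 1/2 ≤ δ) (hδ1 : δ < 1)
    (hα0 : 1/2 ≤ α) (hα1 : α < 1)
    (hβ0 : 1/2 ≤ β) (hβ1 : β < 1)
    (hK : K = δ * (1 - δ) * (1 - p)^2) :
    (α * β * K ≤ (1 - α) * (1 - β) * p^2 ∧
     α * (1 - β) * K ≤ (1 - α) * β * p^2 ∧
     (1 - α) * β * K ≤ α * (1 - β) * p^2 ∧
     (1 - α) * (1 - β) * K ≤ α * β * p^2) ↔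
    β ≤ (1 - α) * p^2 / ((1 - α) * p^2 + α * K) := by
  have hK0 : 0 < K := by
    have h1 : 0 < δ := by linarith
    have h2 : 0 < 1 - δ := by linarith
    have h3 : 0 < 1 - p := by linarith
    rw [hK]
    positivity
  have hp : 0 < p ^ 2 := by positivity
  have hα : 0 < α := by linarith
  have hβ : 0 < β := by linarith
  have hα' : 0 < 1 - α := by linarith
  have hβ' : 0 < 1 - β := by linarith
  have hαα : 1 - α ≤ α := by linarith
  have hββ : 1 - β ≤ β := by linarith
  rw [le_div_iff₀ (by positivity)]
  refine ⟨fun h => by linarith [h.1], fun h => ?_⟩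
  have h1 : α * β * K ≤ (1 - α) * (1 - β) * p ^ 2 := by linarith
  refine ⟨h1, ?_, ?_, ?_⟩
  · calc α * (1 - β) * K ≤ α * β * K := by gcongr
      _ ≤ (1 - α) * (1 - β) * p ^ 2 := h1
      _ ≤ (1 - α) * β * p ^ 2 := by gcongr
  · calc (1 - α) * β * K ≤ α * β * K := by gcongr
      _ ≤ (1 - α) * (1 - β) * p ^ 2 := h1
      _ ≤ α * (1 - β) * p ^ 2 := by gcongr
  · calc (1 - α) * (1 - β) * K ≤ α * β * K := by gcongr
      _ ≤ (1 - α) * (1 - β) * p ^ 2 := h1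
      _ ≤ α * β * p ^ 2 := by gcongr
end

section
/- Let p ∈ (0,1), δ ∈ [1/2,1), α ∈ [1/2,1) and set K = δ(1−δ)(1−p)². There exists β ∈ [1/2,1) satisfying all four inequalities αβK ≤ (1−α)(1−β)p², α(1−β)K ≤ (1−α)βp², (1−α)βK ≤ α(1−β)p², and (1−α)(1−β)K ≤ αβp² if and only if α ≤ p² / (p² + K). -/
/-- There exists a measurement parameter `β ∈ [1/2,1)` satisfying the four
teleportation constraints (a18)–(a21) iff `α ≤ p²/(p² + K)`, where
`K = δ(1−δ)(1−p)²` (Eq. (a25)). -/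
theorem exists_beta_iff_alpha_bound
    (p δ α K : ℝ)
    (hp0 : 0 < p) (hp1 : p < 1)
    (hδ0 : 1/2 ≤ δ) (hδ1 : δ < 1)
    (hα0 : 1/2 ≤ α) (hα1 : α < 1)
    (hK : K = δ * (1 - δ) * (1 - p)^2) :
    (∃ β : ℝ, 1/2 ≤ β ∧ β < 1 ∧
      α * β * K ≤ (1 - α) * (1 - β) * p^2 ∧
      α * (1 - β) * K ≤ (1 - α) * β * p^2 ∧
      (1 - α) * β * K ≤ α * (1 - β) * p^2 ∧
      (1 - α) * (1 - β) * K ≤ α * β * p^2) ↔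
    α ≤ p^2 / (p^2 + K) := by
  have hKpos : 0 < K := by
    have h₁ : 0 < 1 - δ := by linarith
    have h₂ : 0 < 1 - p := by linarith
    have h₃ : 0 < δ := by linarith
    rw [hK]
    positivity
  have hp2 : 0 < p ^ 2 := by positivity
  rw [le_div_iff₀ (by positivity)]
  constructor
  · rintro ⟨β, hβ0, -, h, -, -, -⟩
    have hβ : 0 < β := by linarith
    have hmono : (1 - α) * p ^ 2 * (1 - β) ≤ (1 - α) * p ^ 2 * β :=
      mul_le_mul_of_nonneg_left (by linarith) (mul_nonneg (by linarith) hp2.le)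
    have hcancel : α * K ≤ (1 - α) * p ^ 2 :=
      le_of_mul_le_mul_right (by linarith) hβ
    linarith
  · intro h
    have hK_le : (1 - α) * K ≤ α * K :=
      mul_le_mul_of_nonneg_right (by linarith) hKpos.le
    have hp_le : (1 - α) * p ^ 2 ≤ α * p ^ 2 :=
      mul_le_mul_of_nonneg_right (by linarith) hp2.le
    refine ⟨1 / 2, le_rfl, by norm_num, ?_, ?_, ?_, ?_⟩ <;> linarith
end

section
/- Let n ≥ 1 be a natural number, C ∈ (0,1), p ∈ (0,1), δ ∈ [1/2,1), and set K = δ(1−δ)(1−p)². If (1 + √(1 − C^(2n)))/2 ≤ p²/(p² + K), then (n : ℝ) ≤ |log(1 − ((p² − K)/(p² + K))²)| / (2·|log C|), where log is the natural logarithm. -/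
/-- Upper bound on the number of nodes (Appendix D): if
`(1 + √(1 − C^(2n)))/2 ≤ p²/(p² + K)` with `K = δ(1−δ)(1−p)²`, then
`n ≤ |log(1 − ((p² − K)/(p² + K))²)| / (2|log C|)`. -/
theorem node_number_bound
    (n : ℕ) (hn : 1 ≤ n)
    (C p δ K : ℝ)
    (hC0 : 0 < C) (hC1 : C < 1)
    (hp0 : 0 < p) (hp1 : p < 1)
    (hδ0 : 1/2 ≤ δ) (hδ1 : δ < 1)
    (hK : K = δ * (1 - δ) * (1 - p)^2)
    (h : (1 + Real.sqrt (1 - C^(2*n)))/2 ≤ p^2 / (p^2 + K)) :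
    (n : ℝ) ≤ |Real.log (1 - ((p^2 - K)/(p^2 + K))^2)| / (2 * |Real.log C|) := by
  have hKpos : 0 < K := by
    rw [hK]
    exact mul_pos (mul_pos (by linarith) (by linarith)) (pow_pos (by linarith) 2)
  have hS : 0 < p ^ 2 + K := by positivity
  have hr : (p ^ 2 - K) / (p ^ 2 + K) = 2 * (p ^ 2 / (p ^ 2 + K)) - 1 := by
    field_simp
    ring
  have hr1 : (p ^ 2 - K) / (p ^ 2 + K) < 1 := by
    rw [div_lt_one hS]
    linarith
  have hsqrt : Real.sqrt (1 - C ^ (2 * n)) ≤ (p ^ 2 - K) / (p ^ 2 + K) := by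
    rw [hr]
    linarith
  set r := (p ^ 2 - K) / (p ^ 2 + K)
  have hr0 : 0 ≤ r := (Real.sqrt_nonneg _).trans hsqrt
  have hle : 1 - r ^ 2 ≤ C ^ (2 * n) := by
    linarith [(Real.sqrt_le_left hr0).mp hsqrt]
  have hpos : 0 < 1 - r ^ 2 := by nlinarith
  have hlog : Real.log (1 - r ^ 2) ≤ 2 * n * Real.log C := by
    simpa [Real.log_pow] using Real.log_le_log hpos hle
  have hlogC : Real.log C < 0 := Real.log_neg hC0 hC1
  rw [abs_of_neg hlogC, le_div_iff₀ (by linarith)]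
  linarith [neg_le_abs (Real.log (1 - r ^ 2))]
end

section
/- Let n ≥ 1 be a natural number, C ∈ (0,1), p ∈ (0,1), δ ∈ [1/2,1), and set K = δ(1−δ)(1−p)² and A = 1 − ((p² − K)/(p² + K))². If (1 + √(1 − C^(2n)))/2 ≤ p²/(p² + K), then C ≥ A^(1/(2n)), and consequently the saved resource satisfies n(1 − C) ≤ n(1 − A^(1/(2n))). -/
/-- Saved resource bound (Appendix D): under the optimal-fidelity condition (b4),
the concurrence `C` of the free-segment states satisfies `C ≥ A^(1/(2n))`, hence
the saved resource `R_v = n(1 − C)` satisfies `R_v ≤ n(1 − A^(1/(2n)))`,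
where `K = δ(1−δ)(1−p)²` and `A = 1 − ((p² − K)/(p² + K))²`. -/
theorem saved_resource_bound
    (n : ℕ) (hn : 1 ≤ n)
    (C p δ K A : ℝ)
    (hC0 : 0 < C) (hC1 : C < 1)
    (hp0 : 0 < p) (hp1 : p < 1)
    (hδ0 : 1/2 ≤ δ) (hδ1 : δ < 1)
    (hK : K = δ * (1 - δ) * (1 - p)^2)
    (hA : A = 1 - ((p^2 - K)/(p^2 + K))^2)
    (h : (1 + Real.sqrt (1 - C^(2*n)))/2 ≤ p^2 / (p^2 + K)) :
    A ^ (1 / (2 * (n : ℝ))) ≤ C ∧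
    (n : ℝ) * (1 - C) ≤ (n : ℝ) * (1 - A ^ (1 / (2 * (n : ℝ)))) := by
  have hK0 : 0 ≤ K := by
    rw [hK]
    exact mul_nonneg (mul_nonneg (by linarith) (by linarith)) (sq_nonneg _)
  have hS : 0 < p ^ 2 + K := by positivity
  have hx : Real.sqrt (1 - C ^ (2 * n)) ≤ (p ^ 2 - K) / (p ^ 2 + K) := by
    have hx_eq : (p ^ 2 - K) / (p ^ 2 + K) = 2 * (p ^ 2 / (p ^ 2 + K)) - 1 := by
      field_simp
      ring
    linarith
  have hA0 : 0 ≤ A := by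
    have hA_eq : A = 4 * p ^ 2 * K / (p ^ 2 + K) ^ 2 := by
      rw [hA]
      field_simp
      ring
    rw [hA_eq]
    positivity
  have hAC : A ≤ C ^ (2 * n) := by
    have := (Real.sqrt_le_iff.mp hx).2
    linarith
  have hroot : A ^ (1 / (2 * (n : ℝ))) ≤ C := by
    calc A ^ (1 / (2 * (n : ℝ))) ≤ (C ^ (2 * n)) ^ (1 / (2 * (n : ℝ))) :=
          Real.rpow_le_rpow hA0 hAC (by positivity)
      _ = C := by
          have := Real.pow_rpow_inv_natCast hC0.le (show 2 * n ≠ 0 by omega)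
          simpa only [one_div, Nat.cast_mul, Nat.cast_ofNat] using this
  exact ⟨hroot, by gcongr⟩
end

section
/- Let n ≥ 1 be a natural number, δ ∈ [1/2,1), and 0 < p₁ < p₂ < 1 with δ(1−δ)(1−p₁)² < p₁². For p ∈ (0,1) define K(p) = δ(1−δ)(1−p)² and A(p) = 1 − ((p² − K(p))/(p² + K(p)))². Then n·(1 − A(p₁)^(1/(2n))) < n·(1 − A(p₂)^(1/(2n))). -/
/-- The quotient `(x - k) / (x + k)` strictly increases when `x` grows and `k` shrinks. -/
theorem sub_div_add_lt_sub_div_add {x y k l : ℝ} (hx : 0 < x) (hl : 0 < l)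
    (hxy : x < y) (hlk : l < k) : (x - k) / (x + k) < (y - l) / (y + l) := by
  rw [div_lt_div_iff₀ (by linarith) (by linarith)]
  nlinarith [mul_lt_mul'' hxy hlk hx.le hl.le]

/-- Observation 2: for a fixed number of nodes `n`, the saved-resource bound
`n(1 − A(p)^(1/(2n)))` strictly increases with the noise parameter `p`, where
`K(p) = δ(1−δ)(1−p)²` and `A(p) = 1 − ((p² − K(p))/(p² + K(p)))²`. -/
theorem saved_resource_monotone_in_noise
    (n : ℕ) (hn : 1 ≤ n)
    (δ p₁ p₂ : ℝ)
    (hδ0 : 1/2 ≤ δ) (hδ1 : δ < 1)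
    (hp₁0 : 0 < p₁) (hp₁₂ : p₁ < p₂) (hp₂1 : p₂ < 1)
    (hK₁ : δ * (1 - δ) * (1 - p₁)^2 < p₁^2)
    (K : ℝ → ℝ) (A : ℝ → ℝ)
    (hK : ∀ p, K p = δ * (1 - δ) * (1 - p)^2)
    (hA : ∀ p, A p = 1 - ((p^2 - K p)/(p^2 + K p))^2) :
    (n : ℝ) * (1 - A p₁ ^ (1 / (2 * (n : ℝ)))) <
      (n : ℝ) * (1 - A p₂ ^ (1 / (2 * (n : ℝ)))) := by
  have hc : 0 < δ * (1 - δ) := mul_pos (by linarith) (by linarith)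
  have hp : p₁ ^ 2 < p₂ ^ 2 := by gcongr
  have hK₂pos : 0 < K p₂ := by
    rw [hK]
    exact mul_pos hc (pow_pos (by linarith) 2)
  have hKlt : K p₂ < K p₁ := by
    rw [hK, hK]
    have : 0 ≤ 1 - p₂ := by linarith
    gcongr
  have hK₁lt : K p₁ < p₁ ^ 2 := by rwa [hK]
  have hp₁sq : 0 < p₁ ^ 2 := pow_pos hp₁0 2
  have hratio := sub_div_add_lt_sub_div_add hp₁sq hK₂pos hp hKlt
  have hratio₁ : 0 < (p₁ ^ 2 - K p₁) / (p₁ ^ 2 + K p₁) :=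
    div_pos (by linarith) (by linarith)
  have hratio₂ : (p₂ ^ 2 - K p₂) / (p₂ ^ 2 + K p₂) < 1 := by
    rw [div_lt_one (by linarith)]
    linarith
  have hA₂ : 0 ≤ A p₂ := by
    rw [hA]
    nlinarith
  have hAlt : A p₂ < A p₁ := by
    rw [hA, hA]
    gcongr
  have hn' : (0 : ℝ) < n := by exact_mod_cast hn
  have hpow := Real.rpow_lt_rpow hA₂ hAlt (by positivity : 0 < 1 / (2 * (n : ℝ)))
  gcongr
end

section
/- For p ∈ (0,1) define α(p) = 4p²/(5p² − 2p + 1). Then α is strictly increasing on (0,1), α(p) > 1/2 if and only if p > 1/3, and α(p) < 1 for all p ∈ (0,1). Consequently, for 1/3 < p₁ < p₂ < 1, the binary entropy H(α(p₂)) < H(α(p₁)), where H(x) = −x·log₂ x − (1−x)·log₂(1−x). -/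
/-- The Schmidt coefficient `α(p) = 4p²/(5p² − 2p + 1)` (Eq. (a25) with β = δ = 1/2). -/
noncomputable def alphaFun (p : ℝ) : ℝ := 4 * p^2 / (5 * p^2 - 2 * p + 1)

/-- The binary entropy `H(x) = −x log₂ x − (1−x) log₂ (1−x)`. -/
noncomputable def binEnt (x : ℝ) : ℝ :=
  -x * Real.logb 2 x - (1 - x) * Real.logb 2 (1 - x)

lemma alphaFun_denom_pos (p : ℝ) : 0 < 5 * p^2 - 2 * p + 1 := by
  nlinarith [sq_nonneg (5 * p - 1)]

lemma alphaFun_strictMonoOn : StrictMonoOn alphaFun (Set.Ioo (0:ℝ) 1) := by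
  rintro a ⟨ha₀, ha₁⟩ b ⟨hb₀, hb₁⟩ hab
  unfold alphaFun
  rw [div_lt_div_iff₀ (alphaFun_denom_pos a) (alphaFun_denom_pos b)]
  have h : 0 < a * (1 - b) + b * (1 - a) :=
    add_pos (mul_pos ha₀ (sub_pos.2 hb₁)) (mul_pos hb₀ (sub_pos.2 ha₁))
  linarith [mul_pos (sub_pos.2 hab) h]

lemma half_lt_alphaFun_iff {p : ℝ} (hp : 0 < p) : 1/2 < alphaFun p ↔ 1/3 < p := by
  unfold alphaFun
  rw [div_lt_div_iff₀ two_pos (alphaFun_denom_pos p)]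
  constructor <;> intro h <;> nlinarith

lemma alphaFun_lt_one {p : ℝ} (hp : p < 1) : alphaFun p < 1 := by
  unfold alphaFun
  rw [div_lt_one (alphaFun_denom_pos p)]
  nlinarith [mul_pos (sub_pos.2 hp) (sub_pos.2 hp)]

lemma binEnt_eq_binEntropy_div (x : ℝ) : binEnt x = Real.binEntropy x / Real.log 2 := by
  simp only [binEnt, Real.binEntropy, Real.logb, Real.log_inv]
  ring

lemma binEnt_strictAntiOn : StrictAntiOn binEnt (Set.Icc 2⁻¹ 1) := by
  intro x hx y hy hxy
  rw [binEnt_eq_binEntropy_div, binEnt_eq_binEntropy_div]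
  exact div_lt_div_of_pos_right (Real.binEntropy_strictAntiOn hx hy hxy)
    (Real.log_pos one_lt_two)

/-- `α(p) = 4p²/(5p²−2p+1)` is strictly increasing on `(0,1)`, exceeds `1/2` iff
`p > 1/3`, stays below `1`, and consequently the binary entropy `H(α(p))` is
strictly decreasing on `(1/3, 1)` (fewer copies are needed for noisier states). -/
theorem alphaFun_properties :
    StrictMonoOn alphaFun (Set.Ioo (0:ℝ) 1) ∧
    (∀ p ∈ Set.Ioo (0:ℝ) 1, (1/2 < alphaFun p ↔ 1/3 < p)) ∧
    (∀ p ∈ Set.Ioo (0:ℝ) 1, alphaFun p < 1) ∧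
    (∀ p₁ p₂ : ℝ, 1/3 < p₁ → p₁ < p₂ → p₂ < 1 →
      binEnt (alphaFun p₂) < binEnt (alphaFun p₁)) := by
  refine ⟨alphaFun_strictMonoOn, fun p hp => half_lt_alphaFun_iff hp.1,
    fun p hp => alphaFun_lt_one hp.2, fun p₁ p₂ h₁ h₁₂ h₂ => ?_⟩
  have hmem : ∀ p : ℝ, 1/3 < p → p < 1 → alphaFun p ∈ Set.Icc (2⁻¹ : ℝ) 1 := fun p hp hp' =>
    ⟨by linarith [(half_lt_alphaFun_iff (by linarith)).2 hp], (alphaFun_lt_one hp').le⟩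
  exact binEnt_strictAntiOn (hmem p₁ h₁ (h₁₂.trans h₂)) (hmem p₂ (h₁.trans h₁₂) h₂)
    (alphaFun_strictMonoOn ⟨by linarith, by linarith⟩ ⟨by linarith, h₂⟩ h₁₂)
end

section
/- Let α_l, α_r, δ ∈ [0,1]. With vectors on Fin 2 × Fin 2 over ℂ, let ζ_t (for t ∈ [0,1]) have entries ζ_t(0,0) = √t, ζ_t(1,1) = √(1−t) (others 0), let P = e₍₀,₁₎, and let Φ be the Bell vector with Φ(0,0) = Φ(1,1) = 1/√2 (others 0). Define the double contraction D(v,u,w)(a,b) = ∑_{m,m',n,n' ∈ Fin 2} conj(Φ(m,m'))·conj(Φ(n,n'))·v(a,m)·u(m',n)·w(n',b). Then D(ζ_{α_l}, ζ_δ, ζ_{α_r}) = (1/2)·(√(α_l·α_r·δ)·e₍₀,₀₎ + √((1−α_l)(1−α_r)(1−δ))·e₍₁,₁₎) and D(ζ_{α_l}, P, ζ_{α_r}) = (1/2)·√(α_l(1−α_r))·e₍₀,₁₎. -/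
/-- The Bell vector `Φ = (|00⟩ + |11⟩)/√2`. -/
noncomputable def bellPhi : Fin 2 × Fin 2 → ℂ :=
  fun x => if x = (0, 0) ∨ x = (1, 1) then (1 / Real.sqrt 2 : ℂ) else 0

/-- The double contraction
`D(v,u,w)(a,b) = ∑_{m,m',n,n'} conj(Φ(m,m'))·conj(Φ(n,n'))·v(a,m)·u(m',n)·w(n',b)`,
representing `(I ⊗ ⟨Φ| ⊗ ⟨Φ| ⊗ I)(v ⊗ u ⊗ w)` on the ordering
(A, N₁, N₁′, N₂, N₂′, B). -/
noncomputable def dcontr (v u w : Fin 2 × Fin 2 → ℂ) : Fin 2 × Fin 2 → ℂ :=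
  fun x => ∑ m : Fin 2, ∑ m' : Fin 2, ∑ n : Fin 2, ∑ n' : Fin 2,
    (starRingEnd ℂ) (bellPhi (m, m')) * (starRingEnd ℂ) (bellPhi (n, n')) *
      v (x.1, m) * u (m', n) * w (n', x.2)

theorem conj_bellPhi (m n : Fin 2) :
    (starRingEnd ℂ) (bellPhi (m, n)) = if m = n then (1 / Real.sqrt 2 : ℂ) else 0 := by
  fin_cases m <;> fin_cases n <;> simp [bellPhi]

/-- Bell contractions reduce to half of a matrix product. -/
theorem dcontr_apply (v u w : Fin 2 × Fin 2 → ℂ) (x : Fin 2 × Fin 2) :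
    dcontr v u w x =
      (1 / 2 : ℂ) * ∑ m : Fin 2, ∑ n : Fin 2, v (x.1, m) * u (m, n) * w (n, x.2) := by
  have h : (1 / Real.sqrt 2 : ℂ) * (1 / Real.sqrt 2 : ℂ) = 1 / 2 := by
    rw [div_mul_div_comm, ← Complex.ofReal_mul, Real.mul_self_sqrt (by norm_num)]
    norm_num
  simp only [dcontr, conj_bellPhi, ite_mul, mul_ite, zero_mul, mul_zero, Finset.sum_ite_eq,
    Finset.mem_univ, if_true, h, Finset.mul_sum, ← mul_assoc]
  refine Finset.sum_congr rfl fun m _ => ?_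
  rw [Finset.sum_comm]
  simp only [Finset.sum_ite_eq, Finset.mem_univ, if_true]

/-- Two-node post-measurement components (Eq. (c3) of the paper, Theorem 2):
double Bell contraction of `ζ_{α_l} ⊗ ζ_δ ⊗ ζ_{α_r}` gives the unnormalized
`ζ_{0,0}` component, and of `ζ_{α_l} ⊗ |01⟩ ⊗ ζ_{α_r}` gives the unnormalized
`|01⟩` component. -/
theorem double_contraction_bell
    (αl αr δ : ℝ) (hαl0 : 0 ≤ αl) (hαl1 : αl ≤ 1) (hαr0 : 0 ≤ αr) (hαr1 : αr ≤ 1)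
    (hδ0 : 0 ≤ δ) (hδ1 : δ ≤ 1)
    (ζl ζδ ζr P : Fin 2 × Fin 2 → ℂ)
    (hζl : ζl = fun x => if x = (0, 0) then (Real.sqrt αl : ℂ)
      else if x = (1, 1) then (Real.sqrt (1 - αl) : ℂ) else 0)
    (hζδ : ζδ = fun x => if x = (0, 0) then (Real.sqrt δ : ℂ)
      else if x = (1, 1) then (Real.sqrt (1 - δ) : ℂ) else 0)
    (hζr : ζr = fun x => if x = (0, 0) then (Real.sqrt αr : ℂ)
      else if x = (1, 1) then (Real.sqrt (1 - αr) : ℂ) else 0)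
    (hP : P = fun x => if x = (0, 1) then 1 else 0) :
    dcontr ζl ζδ ζr = (fun x => if x = (0, 0)
        then (1/2 : ℂ) * (Real.sqrt (αl * αr * δ) : ℂ)
        else if x = (1, 1)
        then (1/2 : ℂ) * (Real.sqrt ((1 - αl) * (1 - αr) * (1 - δ)) : ℂ) else 0) ∧
    dcontr ζl P ζr = (fun x => if x = (0, 1)
        then (1/2 : ℂ) * (Real.sqrt (αl * (1 - αr)) : ℂ) else 0) := by
  subst hζl hζδ hζr hP
  have hl : 0 ≤ 1 - αl := sub_nonneg.2 hαl1
  have hr : 0 ≤ 1 - αr := sub_nonneg.2 hαr1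
  constructor
  · rw [Real.sqrt_mul (mul_nonneg hαl0 hαr0), Real.sqrt_mul hαl0,
      Real.sqrt_mul (mul_nonneg hl hr), Real.sqrt_mul hl]
    funext ⟨a, b⟩
    rw [dcontr_apply]
    fin_cases a <;> fin_cases b <;> simp [mul_right_comm]
  · rw [Real.sqrt_mul hαl0]
    funext ⟨a, b⟩
    rw [dcontr_apply]
    fin_cases a <;> fin_cases b <;> simp
end
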